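/- Let H > 0 be a real number with P̄(H) = 0. For δ > 0 let N_δ(F) denote the smallest number of sets of diameter at most δ needed to cover F. Then limsup_{δ → 0⁺} log(N_δ(F))/(−log δ) ≤ H; in other words, the upper box dimension of F is at most H. -/

import Mathlib

open Filter

/-- The weight `c_ω` of a word `ω` over the alphabet `{0,1}` (here `false` is the
letter 0 and `true` is the letter 1): the product of `c0` over letters 0 and `c1`
over letters 1. -/
noncomputable def wt (c0 c1 : ℝ) (w : List Bool) : ℝ :=
  (w.map fun b => if b then c1 else c0).prod

/-- All words of length `n` over the alphabet `{0,1}`. -/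
def allWords : ℕ → Finset (List Bool)
  | 0 => {[]}
  | n + 1 => (allWords n).biUnion fun w => {false :: w, true :: w}

/-- Membership in the language of the S-gap shift: every maximal block of 0s lying
strictly between two 1s has length in `S`. -/
def InLang (S : Set ℕ) (w : List Bool) : Prop :=
  ∀ u v : List Bool, ∀ m : ℕ,
    w = u ++ [true] ++ List.replicate m false ++ [true] ++ v → m ∈ S

/-- Membership in the core set `G`: words of the form `0^{s₁}1 0^{s₂}1 ⋯ 0^{s_k}1`
with `k ≥ 1` and every `s_i ∈ S`. -/
def InCore (S : Set ℕ) (w : List Bool) : Prop :=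
  ∃ bs : List ℕ, bs ≠ [] ∧ (∀ s ∈ bs, s ∈ S) ∧
    w = (bs.map fun s => List.replicate s false ++ [true]).flatten

/-- `L_n`: the words of length `n` in the language of the S-gap shift. -/
noncomputable def langWords (S : Set ℕ) (n : ℕ) : Finset (List Bool) :=
  @Finset.filter _ (InLang S) (Classical.decPred _) (allWords n)

/-- `G_n`: the core words of length `n`. -/
noncomputable def coreWords (S : Set ℕ) (n : ℕ) : Finset (List Bool) :=
  @Finset.filter _ (InCore S) (Classical.decPred _) (allWords n)

/-- The composition `f_{ω₁} ∘ f_{ω₂} ∘ ⋯ ∘ f_{ω_n}` for a word `ω = ω₁⋯ω_n`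
(`false` is the letter 0, giving `f0`; `true` is the letter 1, giving `f1`). -/
def compMap {X : Type*} (f0 f1 : X → X) (w : List Bool) : X → X :=
  w.foldr (fun b g => (if b then f1 else f0) ∘ g) id

/-- The initial segment `ω₁⋯ω_n` of an infinite sequence. -/
def seqPrefix (ω : ℕ → Bool) (n : ℕ) : List Bool := (List.range n).map ω

/-- The positions of the 1s in the sequence `0^n 1 0^{g 0} 1 0^{g 1} 1 ⋯`. -/
def onesPos (n : ℕ) (g : ℕ → ℕ) : ℕ → ℕ
  | 0 => n
  | k + 1 => onesPos n g k + g k + 1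

/-- The sequence `0^n 1 0^{g 0} 1 0^{g 1} 1 ⋯`. -/
noncomputable def buildSeq (n : ℕ) (g : ℕ → ℕ) (i : ℕ) : Bool :=
  @decide (∃ k, onesPos n g k = i) (Classical.propDecidable _)

/-- The S-gap shift `X(S)`: the closure (in the product topology on `{0,1}^ℕ`) of
the set of sequences `0^n 1 0^{s₁} 1 0^{s₂} 1 ⋯` with `n ∈ ℕ` and every `s_i ∈ S`. -/
def XS (S : Set ℕ) : Set (ℕ → Bool) :=
  closure {ω | ∃ (n : ℕ) (g : ℕ → ℕ), (∀ k, g k ∈ S) ∧ ω = buildSeq n g}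

/-- `N_δ(F)`: the smallest number of sets of diameter at most δ needed to cover F. -/
noncomputable def coverNum {X : Type*} [EMetricSpace X] (F : Set X) (δ : ℝ) : ℕ :=
  sInf {N : ℕ | ∃ U : Fin N → Set X,
    F ⊆ ⋃ i, U i ∧ ∀ i, EMetric.diam (U i) ≤ ENNReal.ofReal δ}

lemma mem_allWords {n : ℕ} {w : List Bool} : w ∈ allWords n ↔ w.length = n := by
  induction n generalizing w with
  | zero => simp [allWords]
  | succ n ih =>
    cases w with
    | nil => simp [allWords]
    | cons b w => cases b <;> simp [allWords, ih]

lemma mem_langWords {S : Set ℕ} {n : ℕ} {w : List Bool} :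
    w ∈ langWords S n ↔ w.length = n ∧ InLang S w := by
  simp [langWords, mem_allWords]

lemma strictMono_onesPos (n : ℕ) (g : ℕ → ℕ) : StrictMono (onesPos n g) :=
  strictMono_nat_of_lt_succ fun k => by simp only [onesPos]; omega

lemma buildSeq_eq_true_iff {n : ℕ} {g : ℕ → ℕ} {i : ℕ} :
    buildSeq n g i = true ↔ ∃ k, onesPos n g k = i := by
  simp [buildSeq]

/-- If two positions carry the letter 1 in `0^n 1 0^{g 0} 1 0^{g 1} 1 ⋯` with only 0s between
them, then the number of these 0s is one of the values of `g`. -/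
lemma exists_gap_eq_of_buildSeq {n : ℕ} {g : ℕ → ℕ} {i m : ℕ}
    (hi : buildSeq n g i = true) (hz : ∀ j < m, buildSeq n g (i + 1 + j) = false)
    (he : buildSeq n g (i + 1 + m) = true) : ∃ k, g k = m := by
  obtain ⟨k, hk⟩ := buildSeq_eq_true_iff.1 hi
  obtain ⟨l, hl⟩ := buildSeq_eq_true_iff.1 he
  have hkl : k < l := (strictMono_onesPos n g).lt_iff_lt.1 (by omega)
  have hle : onesPos n g (k + 1) ≤ onesPos n g l := (strictMono_onesPos n g).monotone hkl
  have hsucc : onesPos n g (k + 1) = i + 1 + g k := by simp only [onesPos]; omega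
  refine ⟨k, le_antisymm (by omega) (not_lt.1 fun hlt => ?_)⟩
  have htrue := buildSeq_eq_true_iff.2 ⟨k + 1, hsucc⟩
  rw [hz _ hlt] at htrue
  exact Bool.false_ne_true htrue

lemma length_seqPrefix (ω : ℕ → Bool) (n : ℕ) : (seqPrefix ω n).length = n := by
  simp [seqPrefix]

lemma seqPrefix_succ (ω : ℕ → Bool) (n : ℕ) : seqPrefix ω (n + 1) = seqPrefix ω n ++ [ω n] := by
  simp [seqPrefix, List.range_succ]

lemma eq_of_seqPrefix_eq_append {ω : ℕ → Bool} {N : ℕ} {p q : List Bool} {b : Bool}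
    (h : seqPrefix ω N = p ++ b :: q) : ω p.length = b := by
  have hlen := congrArg List.length h
  simp only [length_seqPrefix, List.length_append, List.length_cons] at hlen
  have hget : (seqPrefix ω N)[p.length]? = some b := by simp [h]
  rw [seqPrefix, List.getElem?_map, List.getElem?_range (by omega)] at hget
  simpa using hget

lemma inLang_seqPrefix_buildSeq {S : Set ℕ} {n : ℕ} {g : ℕ → ℕ} (hg : ∀ k, g k ∈ S) (N : ℕ) :
    InLang S (seqPrefix (buildSeq n g) N) := by
  intro u v m h
  have hi : buildSeq n g u.length = true :=
    eq_of_seqPrefix_eq_append (q := List.replicate m false ++ [true] ++ v)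
      (h.trans (by simp))
  have hz : ∀ j < m, buildSeq n g (u.length + 1 + j) = false := by
    intro j hj
    have hrep : List.replicate m false =
        List.replicate j false ++ false :: List.replicate (m - j - 1) false := by
      rw [← List.replicate_succ, List.replicate_append_replicate]
      congr 1
      omega
    have := eq_of_seqPrefix_eq_append (p := u ++ [true] ++ List.replicate j false)
      (q := List.replicate (m - j - 1) false ++ [true] ++ v) (b := false)
      (h.trans (by rw [hrep]; simp))
    simpa [add_assoc, add_comm 1] using this
  have he : buildSeq n g (u.length + 1 + m) = true := by
    have := eq_of_seqPrefix_eq_append (p := u ++ [true] ++ List.replicate m false)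
      (q := v) (b := true) (h.trans (by simp))
    simpa [add_assoc, add_comm 1] using this
  obtain ⟨k, rfl⟩ := exists_gap_eq_of_buildSeq hi hz he
  exact hg k

/-- Initial segments of elements of the S-gap shift belong to its language. -/
lemma inLang_seqPrefix {S : Set ℕ} {ω : ℕ → Bool} (hω : ω ∈ XS S) (N : ℕ) :
    InLang S (seqPrefix ω N) := by
  have hnhds : (Set.Iio N).pi (fun i => {ω i}) ∈ nhds ω :=
    set_pi_mem_nhds (Set.finite_Iio N) fun i _ => by simp
  obtain ⟨_, hmem, n, g, hg, rfl⟩ := mem_closure_iff_nhds.1 hω _ hnhds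
  have heq : seqPrefix ω N = seqPrefix (buildSeq n g) N :=
    List.map_congr_left fun i hi => (hmem i (List.mem_range.1 hi)).symm
  rw [heq]
  exact inLang_seqPrefix_buildSeq hg N

section Weights

variable {a0 a1 : ℝ}

lemma wt_cons (b : Bool) (w : List Bool) :
    wt a0 a1 (b :: w) = (if b then a1 else a0) * wt a0 a1 w := by
  simp [wt]

lemma wt_append_singleton (w : List Bool) (b : Bool) :
    wt a0 a1 (w ++ [b]) = wt a0 a1 w * (if b then a1 else a0) := by
  simp [wt]

lemma wt_pos (h0 : 0 < a0) (h1 : 0 < a1) (w : List Bool) : 0 < wt a0 a1 w := by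
  induction w with
  | nil => simp [wt]
  | cons b w ih =>
    rw [wt_cons]
    cases b
    · simpa using mul_pos h0 ih
    · simpa using mul_pos h1 ih

lemma wt_le_max_pow (h0 : 0 < a0) (h1 : 0 < a1) (w : List Bool) :
    wt a0 a1 w ≤ max a0 a1 ^ w.length := by
  induction w with
  | nil => simp [wt]
  | cons b w ih =>
    rw [wt_cons, List.length_cons, pow_succ']
    have hb : (if b then a1 else a0) ≤ max a0 a1 := by cases b <;> simp
    exact mul_le_mul hb ih (wt_pos h0 h1 w).le (h0.le.trans (le_max_left _ _))

lemma wt_mul_min_le (h0 : 0 < a0) (h1 : 0 < a1) (w : List Bool) (b : Bool) :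
    wt a0 a1 w * min a0 a1 ≤ wt a0 a1 (w ++ [b]) := by
  rw [wt_append_singleton]
  have hb : min a0 a1 ≤ (if b then a1 else a0) := by cases b <;> simp
  exact mul_le_mul_of_nonneg_left hb (wt_pos h0 h1 w).le

/-- If the pressure vanishes at `H`, then the sums of the `t`-th powers of the weights of the
words of the language converge for every `t > H`. -/
lemma exists_sum_wt_rpow_bound (S : Set ℕ) (h0 : 0 < a0) (h0' : a0 < 1) (h1 : 0 < a1)
    (h1' : a1 < 1) {H t : ℝ} (hHt : H < t)
    (hlim : Tendsto (fun n : ℕ => (1 / (n : ℝ)) * Real.log (∑ ω ∈ langWords S n, wt a0 a1 ω ^ H))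
      atTop (nhds 0)) :
    ∃ Z : ℝ, ∀ M : ℕ, ∑ n ∈ Finset.range M, ∑ ω ∈ langWords S n, wt a0 a1 ω ^ t ≤ Z := by
  set b := max a0 a1 with hb
  have hb0 : 0 < b := h0.trans_le (le_max_left _ _)
  have hblog : Real.log b < 0 := Real.log_neg hb0 (max_lt h0' h1')
  set ε := (t - H) * (-Real.log b) / 2 with hε
  have hεpos : 0 < ε := half_pos (mul_pos (sub_pos.2 hHt) (neg_pos.2 hblog))
  have hnonneg : ∀ n, 0 ≤ ∑ ω ∈ langWords S n, wt a0 a1 ω ^ t := fun n =>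
    Finset.sum_nonneg fun w _ => Real.rpow_nonneg (wt_pos h0 h1 w).le _
  have hev : ∀ᶠ n : ℕ in atTop,
      ‖∑ ω ∈ langWords S n, wt a0 a1 ω ^ t‖ ≤ Real.exp (-ε) ^ n := by
    filter_upwards [hlim.eventually_le_const hεpos, eventually_gt_atTop 0] with n hn hn0
    have hn0' : (0 : ℝ) < n := by exact_mod_cast hn0
    have hsum : ∑ ω ∈ langWords S n, wt a0 a1 ω ^ H ≤ Real.exp (n * ε) := by
      rcases (Finset.sum_nonneg fun w (_ : w ∈ langWords S n) =>
        Real.rpow_nonneg (wt_pos h0 h1 w).le H).eq_or_lt with hz | hpos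
      · rw [← hz]
        positivity
      · rw [← Real.log_le_iff_le_exp hpos]
        rw [one_div, inv_mul_le_iff₀ hn0'] at hn
        exact hn
    rw [Real.norm_of_nonneg (hnonneg n)]
    calc ∑ ω ∈ langWords S n, wt a0 a1 ω ^ t
        ≤ ∑ ω ∈ langWords S n, wt a0 a1 ω ^ H * Real.exp (-(2 * ε * n)) := by
          refine Finset.sum_le_sum fun w hw => ?_
          have hw0 := wt_pos h0 h1 w
          rw [show t = H + (t - H) by ring, Real.rpow_add hw0]
          refine mul_le_mul_of_nonneg_left ?_ (Real.rpow_nonneg hw0.le _)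
          have hle := wt_le_max_pow h0 h1 w
          rw [(mem_langWords.1 hw).1] at hle
          refine (Real.rpow_le_rpow hw0.le hle (sub_pos.2 hHt).le).trans_eq ?_
          rw [Real.rpow_def_of_pos (pow_pos hb0 n), Real.log_pow, hε]
          congr 1
          ring
      _ = (∑ ω ∈ langWords S n, wt a0 a1 ω ^ H) * Real.exp (-(2 * ε * n)) := by
          rw [Finset.sum_mul]
      _ ≤ Real.exp (n * ε) * Real.exp (-(2 * ε * n)) := by gcongr
      _ = Real.exp (-ε) ^ n := by
          rw [← Real.exp_add, ← Real.exp_nat_mul]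
          congr 1
          ring
  have hsummable : Summable fun n => ∑ ω ∈ langWords S n, wt a0 a1 ω ^ t :=
    Summable.of_norm_bounded_eventually_nat (summable_geometric_of_lt_one (Real.exp_pos _).le
      (Real.exp_lt_one_iff.2 (neg_lt_zero.2 hεpos))) hev
  exact ⟨_, fun M => hsummable.sum_le_tsum _ fun n _ => hnonneg n⟩

/-- A sequence has an initial segment whose weight is comparable to a prescribed small scale. -/
lemma exists_wt_seqPrefix_mem_Icc (h0 : 0 < a0) (h1 : 0 < a1) (ω : ℕ → Bool) {ρ : ℝ}
    (hρ : ρ < 1) {M : ℕ} (hM : max a0 a1 ^ M ≤ ρ) :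
    ∃ m < M, wt a0 a1 (seqPrefix ω (m + 1)) ∈ Set.Icc (ρ * min a0 a1) ρ := by
  classical
  have hex : ∃ n, wt a0 a1 (seqPrefix ω n) ≤ ρ :=
    ⟨M, (wt_le_max_pow h0 h1 _).trans (by rwa [length_seqPrefix])⟩
  have hfind := Nat.find_spec hex
  have hle : Nat.find hex ≤ M :=
    Nat.find_min' hex ((wt_le_max_pow h0 h1 _).trans (by rwa [length_seqPrefix]))
  obtain ⟨m, hm⟩ : ∃ m, Nat.find hex = m + 1 := by
    refine Nat.exists_eq_succ_of_ne_zero fun hz => ?_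
    rw [hz] at hfind
    simp only [seqPrefix, wt, List.range_zero, List.map_nil, List.prod_nil] at hfind
    linarith
  rw [hm] at hfind
  refine ⟨m, by omega, ?_, hfind⟩
  have hlt : ρ < wt a0 a1 (seqPrefix ω m) := not_le.1 (Nat.find_min hex (by omega))
  rw [seqPrefix_succ]
  exact (mul_le_mul_of_nonneg_right hlt.le (lt_min h0 h1).le).trans (wt_mul_min_le h0 h1 _ _)

end Weights

lemma coverNum_le_card {X ι : Type*} [EMetricSpace X] {F : Set X} {δ : ℝ} (s : Finset ι)
    (U : ι → Set X) (hF : F ⊆ ⋃ i ∈ s, U i)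
    (hU : ∀ i ∈ s, Metric.ediam (U i) ≤ ENNReal.ofReal δ) : coverNum F δ ≤ s.card := by
  refine Nat.sInf_le ⟨fun i => U (s.equivFin.symm i), fun x hx => ?_, fun i => hU _ (by simp)⟩
  obtain ⟨i, hi, hxi⟩ := Set.mem_iUnion₂.1 (hF hx)
  exact Set.mem_iUnion.2 ⟨s.equivFin ⟨i, hi⟩, by simpa using hxi⟩

section Contractions

variable {E : Type*} [SeminormedAddCommGroup E] {K : Set E} {f0 f1 : E → E} {a0 a1 : ℝ}

lemma compMap_mem {X : Type*} {K : Set X} {f0 f1 : X → X} (hf0K : f0 '' K ⊆ K)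
    (hf1K : f1 '' K ⊆ K) (w : List Bool) {x : X} (hx : x ∈ K) : compMap f0 f1 w x ∈ K := by
  induction w with
  | nil => exact hx
  | cons b w ih =>
    cases b
    · exact hf0K ⟨_, ih, rfl⟩
    · exact hf1K ⟨_, ih, rfl⟩

lemma norm_compMap_sub_le (h0 : 0 < a0) (h1 : 0 < a1)
    (hf0K : f0 '' K ⊆ K) (hf1K : f1 '' K ⊆ K)
    (hf0 : ∀ x ∈ K, ∀ y ∈ K, ‖f0 x - f0 y‖ ≤ a0 * ‖x - y‖)
    (hf1 : ∀ x ∈ K, ∀ y ∈ K, ‖f1 x - f1 y‖ ≤ a1 * ‖x - y‖)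
    (w : List Bool) {x y : E} (hx : x ∈ K) (hy : y ∈ K) :
    ‖compMap f0 f1 w x - compMap f0 f1 w y‖ ≤ wt a0 a1 w * ‖x - y‖ := by
  induction w with
  | nil => simp [compMap, wt]
  | cons b w ih =>
    rw [wt_cons, mul_assoc]
    have hx' := compMap_mem hf0K hf1K w hx
    have hy' := compMap_mem hf0K hf1K w hy
    cases b
    · exact (hf0 _ hx' _ hy').trans (mul_le_mul_of_nonneg_left ih h0.le)
    · exact (hf1 _ hx' _ hy').trans (mul_le_mul_of_nonneg_left ih h1.le)

end Contractions

/-- If the sums of the `t`-th powers of the weights of the words of the language are bounded,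
then the covering numbers of the subfractal are `O(δ ^ (-t))`. -/
lemma exists_coverNum_bound {E : Type*} [NormedAddCommGroup E] (S : Set ℕ) {a0 a1 : ℝ}
    (h0 : 0 < a0) (h0' : a0 < 1) (h1 : 0 < a1) (h1' : a1 < 1) {t : ℝ} (ht : 0 < t) {Z : ℝ}
    (hZ : ∀ M : ℕ, ∑ n ∈ Finset.range M, ∑ ω ∈ langWords S n, wt a0 a1 ω ^ t ≤ Z)
    {K : Set E} (hK : Bornology.IsBounded K) {f0 f1 : E → E}
    (hf0K : f0 '' K ⊆ K) (hf1K : f1 '' K ⊆ K)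
    (hf0 : ∀ x ∈ K, ∀ y ∈ K, ‖f0 x - f0 y‖ ≤ a0 * ‖x - y‖)
    (hf1 : ∀ x ∈ K, ∀ y ∈ K, ‖f1 x - f1 y‖ ≤ a1 * ‖x - y‖)
    {π : (ℕ → Bool) → E}
    (hπ : ∀ ω ∈ XS S, (⋂ n : ℕ, compMap f0 f1 (seqPrefix ω (n + 1)) '' K) = {π ω}) :
    ∃ C : ℝ, 0 < C ∧ ∀ δ : ℝ, 0 < δ → δ < 1 → (coverNum (π '' XS S) δ : ℝ) ≤ C * δ ^ (-t) := by
  classical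
  set D := Metric.diam K + 1 with hD
  have hD1 : 1 ≤ D := by linarith [Metric.diam_nonneg (s := K)]
  have hD0 : 0 < D := zero_lt_one.trans_le hD1
  have ha : 0 < min a0 a1 := lt_min h0 h1
  have hκ : 0 < (min a0 a1 / D) ^ t := Real.rpow_pos_of_pos (div_pos ha hD0) t
  have hZ0 : 0 ≤ Z := by simpa using hZ 0
  refine ⟨(Z + 1) / (min a0 a1 / D) ^ t, by positivity, fun δ hδ hδ1 => ?_⟩
  have hρ0 : 0 < δ / D := div_pos hδ hD0
  have hρ1 : δ / D < 1 := (div_lt_one hD0).2 (hδ1.trans_le hD1)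
  obtain ⟨M, hM⟩ := exists_pow_lt_of_lt_one hρ0 (max_lt h0' h1')
  set s := ((Finset.range (M + 1)).biUnion (langWords S)).filter
    (fun w => wt a0 a1 w ∈ Set.Icc (δ / D * min a0 a1) (δ / D)) with hs
  have hcover : coverNum (π '' XS S) δ ≤ s.card := by
    refine coverNum_le_card s (fun w => compMap f0 f1 w '' K) ?_ ?_
    · rintro _ ⟨ω, hω, rfl⟩
      obtain ⟨m, hmM, hm⟩ := exists_wt_seqPrefix_mem_Icc h0 h1 ω hρ1 hM.le
      refine Set.mem_iUnion₂.2 ⟨seqPrefix ω (m + 1), ?_, ?_⟩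
      · refine Finset.mem_filter.2 ⟨Finset.mem_biUnion.2 ⟨m + 1, ?_, ?_⟩, hm⟩
        · exact Finset.mem_range.2 (by omega)
        · exact mem_langWords.2 ⟨length_seqPrefix _ _, inLang_seqPrefix hω _⟩
      · have hmem : π ω ∈ ⋂ n : ℕ, compMap f0 f1 (seqPrefix ω (n + 1)) '' K := by
          rw [hπ ω hω]
          rfl
        exact Set.mem_iInter.1 hmem m
    · intro w hw
      refine Metric.ediam_le ?_
      rintro _ ⟨x, hx, rfl⟩ _ ⟨y, hy, rfl⟩
      rw [edist_dist, dist_eq_norm]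
      refine ENNReal.ofReal_le_ofReal ?_
      have hxy : ‖x - y‖ ≤ D := by
        rw [← dist_eq_norm]
        linarith [Metric.dist_le_diam_of_mem hK hx hy]
      calc ‖compMap f0 f1 w x - compMap f0 f1 w y‖
          ≤ wt a0 a1 w * ‖x - y‖ := norm_compMap_sub_le h0 h1 hf0K hf1K hf0 hf1 w hx hy
        _ ≤ δ / D * D :=
          mul_le_mul (Finset.mem_filter.1 hw).2.2 hxy (norm_nonneg _) hρ0.le
        _ = δ := div_mul_cancel₀ _ hD0.ne'
  have hcard : (s.card : ℝ) * (δ / D * min a0 a1) ^ t ≤ Z := by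
    calc (s.card : ℝ) * (δ / D * min a0 a1) ^ t
        = ∑ _w ∈ s, (δ / D * min a0 a1) ^ t := by rw [Finset.sum_const, nsmul_eq_mul]
      _ ≤ ∑ w ∈ s, wt a0 a1 w ^ t := Finset.sum_le_sum fun w hw =>
          Real.rpow_le_rpow (by positivity) (Finset.mem_filter.1 hw).2.1 ht.le
      _ ≤ ∑ w ∈ (Finset.range (M + 1)).biUnion (langWords S), wt a0 a1 w ^ t :=
          Finset.sum_le_sum_of_subset_of_nonneg (Finset.filter_subset _ _)
            fun w _ _ => Real.rpow_nonneg (wt_pos h0 h1 w).le _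
      _ = ∑ n ∈ Finset.range (M + 1), ∑ w ∈ langWords S n, wt a0 a1 w ^ t := by
          refine Finset.sum_biUnion fun i _ j _ hij => Finset.disjoint_left.2 fun w hi hj => ?_
          exact hij ((mem_langWords.1 hi).1.symm.trans (mem_langWords.1 hj).1)
      _ ≤ Z := hZ _
  rw [show δ / D * min a0 a1 = min a0 a1 / D * δ by ring,
    Real.mul_rpow (div_pos ha hD0).le hδ.le] at hcard
  have hδt : 0 < δ ^ t := Real.rpow_pos_of_pos hδ t
  rw [Real.rpow_neg hδ.le, ← div_eq_mul_inv, div_div, le_div_iff₀ (mul_pos hκ hδt)]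
  have hcover' : (coverNum (π '' XS S) δ : ℝ) ≤ s.card := by exact_mod_cast hcover
  exact (mul_le_mul_of_nonneg_right hcover' (mul_pos hκ hδt).le).trans (by linarith)

/-- If H > 0 and P̄(H) = 0, then
limsup_{δ → 0⁺} log(N_δ(F))/(−log δ) ≤ H, i.e. the upper box dimension of
F = π(X(S)) is at most H. -/
theorem stmt12
    (S : Set ℕ) (hS : S.Infinite)
    (c0 c1 cb0 cb1 : ℝ)
    (hc0 : 0 < c0) (hc0b : c0 ≤ cb0) (hcb0 : cb0 < 1)
    (hc1 : 0 < c1) (hc1b : c1 ≤ cb1) (hcb1 : cb1 < 1)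
    (P Pb : ℝ → ℝ)
    (hP : ∀ t : ℝ, Filter.Tendsto
      (fun n : ℕ => (1 / (n : ℝ)) * Real.log (∑ ω ∈ langWords S n, wt c0 c1 ω ^ t))
      Filter.atTop (nhds (P t)))
    (hPb : ∀ t : ℝ, Filter.Tendsto
      (fun n : ℕ => (1 / (n : ℝ)) * Real.log (∑ ω ∈ langWords S n, wt cb0 cb1 ω ^ t))
      Filter.atTop (nhds (Pb t)))
    (d : ℕ)
    (K : Set (EuclideanSpace ℝ (Fin d))) (hKne : K.Nonempty) (hKcomp : IsCompact K)
    (f0 f1 : EuclideanSpace ℝ (Fin d) → EuclideanSpace ℝ (Fin d))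
    (hf0K : f0 '' K ⊆ K) (hf1K : f1 '' K ⊆ K)
    (hf0 : ∀ x ∈ K, ∀ y ∈ K,
      c0 * ‖x - y‖ ≤ ‖f0 x - f0 y‖ ∧ ‖f0 x - f0 y‖ ≤ cb0 * ‖x - y‖)
    (hf1 : ∀ x ∈ K, ∀ y ∈ K,
      c1 * ‖x - y‖ ≤ ‖f1 x - f1 y‖ ∧ ‖f1 x - f1 y‖ ≤ cb1 * ‖x - y‖)
    (V : Set (EuclideanSpace ℝ (Fin d))) (hVopen : IsOpen V) (hVne : V.Nonempty)
    (hVK : closure V ⊆ K)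
    (hOSC1 : f0 '' V ∪ f1 '' V ⊆ V) (hOSC2 : f0 '' V ∩ f1 '' V = ∅)
    (π : (ℕ → Bool) → EuclideanSpace ℝ (Fin d))
    (hπ : ∀ ω ∈ XS S, (⋂ n : ℕ, compMap f0 f1 (seqPrefix ω (n + 1)) '' K) = {π ω})
    (H : ℝ) (hH : 0 < H) (hPH : Pb H = 0) :
    Filter.limsup
        (fun δ : ℝ =>
          ((Real.log (coverNum (π '' XS S) δ) / (-Real.log δ) : ℝ) : EReal))
        (nhdsWithin 0 (Set.Ioi 0)) ≤ (H : EReal) := by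
  have h0 : 0 < cb0 := hc0.trans_le hc0b
  have h1 : 0 < cb1 := hc1.trans_le hc1b
  rw [← EReal.le_of_forall_lt_iff_le]
  intro t ht
  have ht' : H < t := by exact_mod_cast ht
  obtain ⟨s, hHs, hst⟩ := exists_between ht'
  have hs : 0 < s := hH.trans hHs
  have hlim := hPb H
  rw [hPH] at hlim
  obtain ⟨Z, hZ⟩ := exists_sum_wt_rpow_bound S h0 hcb0 h1 hcb1 hHs hlim
  obtain ⟨C, hC0, hC⟩ := exists_coverNum_bound S h0 hcb0 h1 hcb1 hs hZ hKcomp.isBounded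
    hf0K hf1K (fun x hx y hy => (hf0 x hx y hy).2) (fun x hx y hy => (hf1 x hx y hy).2) hπ
  have hlog : Tendsto (fun δ : ℝ => (t - s) * (-Real.log δ)) (nhdsWithin 0 (Set.Ioi 0)) atTop :=
    Tendsto.const_mul_atTop (by linarith)
      (tendsto_neg_atBot_atTop.comp Real.tendsto_log_nhdsGT_zero)
  refine limsup_le_of_le (by isBoundedDefault) ?_
  have hmem : Set.Ioo (0 : ℝ) 1 ∈ nhdsWithin (0 : ℝ) (Set.Ioi 0) :=
    Ioo_mem_nhdsGT zero_lt_one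
  filter_upwards [hmem, hlog.eventually_ge_atTop (Real.log C), hlog.eventually_ge_atTop 0]
    with δ hδ hlarge hnonneg
  have hneg : 0 < -Real.log δ := by
    have := Real.log_neg hδ.1 hδ.2
    linarith
  rw [EReal.coe_le_coe_iff, div_le_iff₀ hneg]
  rcases Nat.eq_zero_or_pos (coverNum (π '' XS S) δ) with hz | hpos
  · rw [hz]
    simp only [Nat.cast_zero, Real.log_zero]
    exact mul_nonneg (hH.trans ht').le hneg.le
  · have hpos' : (0 : ℝ) < coverNum (π '' XS S) δ := by exact_mod_cast hpos
    have hle := Real.log_le_log hpos' (hC δ hδ.1 hδ.2)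
    rw [Real.log_mul hC0.ne' (Real.rpow_pos_of_pos hδ.1 _).ne', Real.log_rpow hδ.1] at hle
    linarith
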